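/- Let F = {f_1,…,f_N} and G = {g_1,…,g_N} be post-critically finite IFSs of bi-Lipschitz contractions on complete metric spaces (X,d_1) and (Y,d_2), with attractors K and K' respectively. Assume (i) both F and G satisfy the single intersection condition and the angle separation condition, and (ii) F and G have the same topology automaton, rendered combinatorially as: for every n ≥ 1 and all words I, J ∈ {1,…,N}^n, f_I(K) ∩ f_J(K) = ∅ if and only if g_I(K') ∩ g_J(K') = ∅. Then (K,d_1) and (K',d_2) are Hölder equivalent: there exist a homeomorphism h : K → K' and constants C ≥ 1, s ∈ (0,1] such that C^{-1}·d_1(x,y)^{1/s} ≤ d_2(h(x),h(y)) ≤ C·d_1(x,y)^s for all x,y ∈ K. -/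

import Mathlib

open Set Metric
open scoped ENNReal

/-- `wordMap f [i₁,…,i_k] = f i₁ ∘ ⋯ ∘ f i_k`. -/
def wordMap {X : Type*} {ι : Type*} (f : ι → X → X) : List ι → X → X
  | [] => id
  | i :: I => f i ∘ wordMap f I

/-- The prefix word `x₁ ⋯ x_n` of an infinite word `x`. -/
def pre {ι : Type*} (x : ℕ → ι) (n : ℕ) : List ι := List.ofFn (fun j : Fin n => x j)

/-- `K` is the attractor of the IFS `f`: the (unique) nonempty compact set with
`K = ⋃ i, f i '' K`. -/
def IsAttractor {X : Type*} [MetricSpace X] {ι : Type*} (f : ι → X → X) (K : Set X) : Prop :=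
  K.Nonempty ∧ IsCompact K ∧ K = ⋃ i, f i '' K

/-- `g` is a bi-Lipschitz contraction. -/
def IsBiLipContraction {X : Type*} [MetricSpace X] (g : X → X) : Prop :=
  ∃ A B : ℝ, 0 < A ∧ B < 1 ∧ ∀ x y : X,
    A * dist x y ≤ dist (g x) (g y) ∧ dist (g x) (g y) ≤ B * dist x y

/-- `g` is a similitude of ratio `r`. -/
def IsSimilitude {X : Type*} [MetricSpace X] (g : X → X) (r : ℝ) : Prop :=
  ∀ x y : X, dist (g x) (g y) = r * dist x y

/-- The critical set `C_F = ⋃_{i ≠ j} f_i(K) ∩ f_j(K)`. -/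
def criticalSet {X : Type*} {ι : Type*} (f : ι → X → X) (K : Set X) : Set X :=
  ⋃ (i : ι) (j : ι) (_ : i ≠ j), (f i '' K) ∩ (f j '' K)

/-- The post-critical set `P_F = ⋃_{ω ∈ Σ^*} f_ω⁻¹(C_F) ∩ K`. -/
def postCriticalSet {X : Type*} {ι : Type*} (f : ι → X → X) (K : Set X) : Set X :=
  {p | p ∈ K ∧ ∃ I : List ι, I ≠ [] ∧ wordMap f I p ∈ criticalSet f K}

/-- `π` is the coding map of `(f, K)`: `{π x} = ⋂_k f_{x₁⋯x_k}(K)`. -/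
def IsCodingMap {X : Type*} {ι : Type*} (f : ι → X → X) (K : Set X)
    (π : (ℕ → ι) → X) : Prop :=
  ∀ x : ℕ → ι, (⋂ k : ℕ, wordMap f (pre x (k + 1)) '' K) = {π x}

/-- Single intersection condition: `f_i(K) ∩ f_j(K)` contains at most one point for `i ≠ j`. -/
def SIC {X : Type*} {ι : Type*} (f : ι → X → X) (K : Set X) : Prop :=
  ∀ i j : ι, i ≠ j → ((f i '' K) ∩ (f j '' K)).Subsingleton

/-- Angle separation condition with respect to a distance function `D`. -/
def ASCwrt {X : Type*} {ι : Type*} (f : ι → X → X) (K : Set X) (D : X → X → ℝ) : Prop :=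
  ∃ c : ℝ, 0 < c ∧ ∀ i j : ι, i ≠ j → ∀ z : X, (f i '' K) ∩ (f j '' K) = {z} →
    ∀ x ∈ f i '' K, ∀ y ∈ f j '' K, c * max (D x z) (D y z) ≤ D x y

/-- Angle separation condition. -/
def ASC {X : Type*} [MetricSpace X] {ι : Type*} (f : ι → X → X) (K : Set X) : Prop :=
  ASCwrt f K dist

/-- Lexicographic order on infinite words. -/
def lexLe {ι : Type*} [LinearOrder ι] (x y : ℕ → ι) : Prop :=
  x = y ∨ ∃ n : ℕ, (∀ k < n, x k = y k) ∧ x n < y n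

/-- `Σ_K`: the set of lowest codings, i.e. of words that are lexicographically least
among all words with the same image under the coding map `π`. -/
def lowestCodings {X : Type*} {ι : Type*} [LinearOrder ι] (π : (ℕ → ι) → X) :
    Set (ℕ → ι) :=
  {x | ∀ y : ℕ → ι, π y = π x → lexLe x y}

/-- `∂Σ_K`: the set of first letters of codings of post-critical points. -/
def bdryLetters {X : Type*} {ι : Type*} (f : ι → X → X) (K : Set X)
    (π : (ℕ → ι) → X) : Set ι :=
  {i | ∃ x : ℕ → ι, π x ∈ postCriticalSet f K ∧ x 0 = i}

/-- The contraction ratio `r_I = r_{i₁} ⋯ r_{i_k}` of a word. -/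
def rword {ι : Type*} (r : ι → ℝ) (I : List ι) : ℝ := (I.map r).prod

/-- Over a finite index type, positive thresholds for downward closed properties can be chosen
uniformly. -/
theorem exists_pos_forall_of_antitone {ι : Type*} [Finite ι] (P : ι → ℝ → Prop)
    (hP : ∀ i ε ε', P i ε → ε' ≤ ε → P i ε') (h : ∀ i, ∃ ε, 0 < ε ∧ P i ε) :
    ∃ ε, 0 < ε ∧ ∀ i, P i ε := by
  choose e he hPe using h
  have hev : ∀ᶠ ε in nhdsWithin (0 : ℝ) (Ioi 0), ∀ i, ε < e i :=
    Filter.eventually_all.2 fun i => nhdsWithin_le_nhds (Iio_mem_nhds (he i))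
  obtain ⟨ε, hε, hlt⟩ := (eventually_mem_nhdsWithin.and hev).exists
  exact ⟨ε, hε, fun i => hP i _ _ (hPe i) (hlt i).le⟩

/-- A finite family of bi-Lipschitz contractions has common Lipschitz bounds, and these may be
pushed arbitrarily close to `0` and `1`. -/
theorem exists_uniform_biLipschitz {X : Type*} [MetricSpace X] {ι : Type*} [Finite ι]
    {f : ι → X → X} (hf : ∀ i, IsBiLipContraction (f i)) :
    ∃ ε, 0 < ε ∧ ∀ ε' ≤ ε, ∀ i x y,
      ε' * dist x y ≤ dist (f i x) (f i y) ∧ dist (f i x) (f i y) ≤ (1 - ε') * dist x y := by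
  obtain ⟨ε, hε, h⟩ := exists_pos_forall_of_antitone
    (fun i ε => ∀ x y, ε * dist x y ≤ dist (f i x) (f i y) ∧
      dist (f i x) (f i y) ≤ (1 - ε) * dist x y)
    (fun i ε ε' h hle x y =>
      ⟨(mul_le_mul_of_nonneg_right hle dist_nonneg).trans (h x y).1,
        (h x y).2.trans (mul_le_mul_of_nonneg_right (by linarith) dist_nonneg)⟩)
    (fun i => by
      obtain ⟨A, B, hA, hB, h⟩ := hf i
      refine ⟨min A (1 - B), lt_min hA (by linarith), fun x y => ⟨?_, ?_⟩⟩
      · exact (mul_le_mul_of_nonneg_right (min_le_left _ _) dist_nonneg).trans (h x y).1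
      · refine (h x y).2.trans (mul_le_mul_of_nonneg_right ?_ dist_nonneg)
        linarith [min_le_right A (1 - B)])
  exact ⟨ε, hε, fun ε' hle i x y =>
    ⟨(mul_le_mul_of_nonneg_right hle dist_nonneg).trans (h i x y).1,
      (h i x y).2.trans (mul_le_mul_of_nonneg_right (by linarith) dist_nonneg)⟩⟩

section Words

variable {X : Type*} {ι : Type*}

theorem pre_succ (x : ℕ → ι) (n : ℕ) : pre x (n + 1) = pre x n ++ [x n] := by
  rw [pre, List.ofFn_succ_last]
  rfl

theorem pre_succ_cons (x : ℕ → ι) (n : ℕ) :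
    pre x (n + 1) = x 0 :: pre (fun k => x (k + 1)) n := by
  simp [pre, List.ofFn_succ]

theorem length_pre (x : ℕ → ι) (n : ℕ) : (pre x n).length = n := by simp [pre]

theorem wordMap_append_singleton (f : ι → X → X) (I : List ι) (a : ι) (x : X) :
    wordMap f (I ++ [a]) x = wordMap f I (f a x) := by
  induction I with
  | nil => rfl
  | cons i I ih => simp [wordMap, ih]

theorem wordMap_mem {f : ι → X → X} {K : Set X} (hfK : ∀ i, MapsTo (f i) K K) (I : List ι)
    {x : X} (hx : x ∈ K) : wordMap f I x ∈ K := by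
  induction I with
  | nil => exact hx
  | cons i I ih => exact hfK i ih

end Words

section Attractor

variable {X : Type*} [MetricSpace X] {ι : Type*} {f : ι → X → X} {K : Set X}

theorem IsAttractor.mapsTo (hK : IsAttractor f K) (i : ι) : MapsTo (f i) K K := by
  intro x hx
  rw [hK.2.2]
  exact mem_iUnion.2 ⟨i, x, hx, rfl⟩

theorem IsCodingMap.mem_cylinder {π : (ℕ → ι) → X} (hK : IsAttractor f K)
    (hπ : IsCodingMap f K π) (x : ℕ → ι) (n : ℕ) : π x ∈ wordMap f (pre x n) '' K := by
  have h : π x ∈ ⋂ k : ℕ, wordMap f (pre x (k + 1)) '' K := by rw [hπ x]; rfl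
  obtain ⟨p, hp, hpx⟩ := mem_iInter.1 h n
  rw [pre_succ, wordMap_append_singleton] at hpx
  exact ⟨f (x n) p, hK.mapsTo _ hp, hpx⟩

theorem IsCodingMap.mem {π : (ℕ → ι) → X} (hK : IsAttractor f K)
    (hπ : IsCodingMap f K π) (x : ℕ → ι) : π x ∈ K := by
  obtain ⟨p, hp, hpx⟩ := hπ.mem_cylinder hK x 0
  exact hpx ▸ hp

theorem IsCodingMap.exists_code {π : (ℕ → ι) → X} (hK : IsAttractor f K)
    (hπ : IsCodingMap f K π) {p : X} (hp : p ∈ K) : ∃ x, π x = p := by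
  have hstep : ∀ q : K, ∃ i, ∃ q' : K, f i q' = q := by
    intro q
    have hq : (q : X) ∈ ⋃ i, f i '' K := hK.2.2 ▸ q.2
    obtain ⟨i, q', hq', h⟩ := mem_iUnion.1 hq
    exact ⟨i, ⟨q', hq'⟩, h⟩
  choose a b hab using hstep
  have hcyl : ∀ (n : ℕ) (q : K), wordMap f (pre (fun k => a (b^[k] q)) n) (b^[n] q) = q := by
    intro n
    induction n with
    | zero => intro q; rfl
    | succ n ih =>
      intro q
      rw [pre_succ_cons]
      have := ih (b q)
      simp only [Function.iterate_succ_apply, wordMap, Function.comp_apply,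
        Function.iterate_zero_apply] at this ⊢
      rw [this, hab]
  refine ⟨fun k => a (b^[k] ⟨p, hp⟩), ?_⟩
  have h : p ∈ ⋂ k : ℕ, wordMap f (pre (fun k => a (b^[k] ⟨p, hp⟩)) (k + 1)) '' K :=
    mem_iInter.2 fun k => ⟨_, Subtype.coe_prop _, hcyl (k + 1) ⟨p, hp⟩⟩
  rw [hπ] at h
  exact (mem_singleton_iff.1 h).symm

theorem pow_length_mul_dist_le {A : ℝ} (hA : 0 ≤ A)
    (hf : ∀ i x y, A * dist x y ≤ dist (f i x) (f i y)) (I : List ι) (x y : X) :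
    A ^ I.length * dist x y ≤ dist (wordMap f I x) (wordMap f I y) := by
  induction I with
  | nil => simp [wordMap]
  | cons i I ih =>
    calc A ^ (i :: I).length * dist x y = A * (A ^ I.length * dist x y) := by
          rw [List.length_cons]; ring
      _ ≤ A * dist (wordMap f I x) (wordMap f I y) := mul_le_mul_of_nonneg_left ih hA
      _ ≤ _ := hf i _ _

theorem dist_wordMap_le {B : ℝ} (hB : 0 ≤ B)
    (hf : ∀ i x y, dist (f i x) (f i y) ≤ B * dist x y) (I : List ι) (x y : X) :
    dist (wordMap f I x) (wordMap f I y) ≤ B ^ I.length * dist x y := by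
  induction I with
  | nil => simp [wordMap]
  | cons i I ih =>
    calc _ ≤ B * dist (wordMap f I x) (wordMap f I y) := hf i _ _
      _ ≤ B * (B ^ I.length * dist x y) := mul_le_mul_of_nonneg_left ih hB
      _ = B ^ (i :: I).length * dist x y := by rw [List.length_cons]; ring

/-- Points with codings whose cylinders of level `n` meet are at distance `O(B ^ n)`. -/
theorem IsCodingMap.dist_le_of_cylinders_meet {π : (ℕ → ι) → X} (hK : IsAttractor f K)
    (hπ : IsCodingMap f K π) {B : ℝ} (hB : 0 ≤ B)
    (hf : ∀ i x y, dist (f i x) (f i y) ≤ B * dist x y) {x y : ℕ → ι} {n : ℕ}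
    (h : (wordMap f (pre x n) '' K ∩ wordMap f (pre y n) '' K).Nonempty) :
    dist (π x) (π y) ≤ 2 * diam K * B ^ n := by
  have hcyl : ∀ w : ℕ → ι, ∀ z ∈ wordMap f (pre w n) '' K, dist (π w) z ≤ B ^ n * diam K := by
    rintro w _ ⟨q, hq, rfl⟩
    obtain ⟨p, hp, hpw⟩ := hπ.mem_cylinder hK w n
    rw [← hpw]
    have := dist_wordMap_le hB hf (pre w n) p q
    rw [length_pre] at this
    exact this.trans (mul_le_mul_of_nonneg_left
      (dist_le_diam_of_mem hK.2.1.isBounded hp hq) (pow_nonneg hB n))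
  obtain ⟨z, hzx, hzy⟩ := h
  have h1 := hcyl x z hzx
  have h2 := hcyl y z hzy
  have h3 := dist_triangle_right (π x) (π y) z
  linarith

/-- Cylinders that are disjoint while their parents of level `n` meet are separated by a
constant multiple of `A ^ n`. -/
theorem exists_cylinder_separation [Finite ι] (hK : IsAttractor f K)
    (hP : (postCriticalSet f K).Finite) (hSIC : SIC f K) (hASC : ASC f K) {A : ℝ} (hA : 0 < A)
    (hfc : ∀ i, Continuous (f i)) (hf : ∀ i x y, A * dist x y ≤ dist (f i x) (f i y)) :
    ∃ c, 0 < c ∧ ∀ (I J : List ι) (a b : ι), I.length = J.length →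
      (wordMap f I '' K ∩ wordMap f J '' K).Nonempty →
      wordMap f (I ++ [a]) '' K ∩ wordMap f (J ++ [b]) '' K = ∅ →
      ∀ u ∈ K, ∀ v ∈ K,
        c * A ^ I.length ≤ dist (wordMap f (I ++ [a]) u) (wordMap f (J ++ [b]) v) := by
  have hcomp : ∀ i, IsCompact (f i '' K) := fun i => hK.2.1.image (hfc i)
  have hinj : ∀ i, Function.Injective (f i) := by
    intro i x y hxy
    have := hf i x y
    rw [hxy, dist_self] at this
    exact dist_le_zero.1 (nonpos_of_mul_nonpos_right this hA)
  obtain ⟨δ, hδ, hdisj⟩ := exists_pos_forall_of_antitone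
    (fun (ab : ι × ι) (ε : ℝ) => f ab.1 '' K ∩ f ab.2 '' K = ∅ →
      ∀ u ∈ f ab.1 '' K, ∀ v ∈ f ab.2 '' K, ε ≤ dist u v)
    (fun _ _ _ h hle he u hu v hv => hle.trans (h he u hu v hv))
    (fun ab => by
      by_cases he : f ab.1 '' K ∩ f ab.2 '' K = ∅
      · obtain ⟨r, hr, h⟩ := Metric.exists_pos_forall_lt_edist (hcomp ab.1)
          (hcomp ab.2).isClosed (disjoint_iff_inter_eq_empty.2 he)
        refine ⟨r, by exact_mod_cast hr, fun _ u hu v hv => ?_⟩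
        have := h u hu v hv
        rw [edist_nndist] at this
        rw [← coe_nndist]
        exact_mod_cast this.le
      · exact ⟨1, one_pos, fun h => absurd h he⟩)
  have := hP.to_subtype
  obtain ⟨η, hη, hpc⟩ := exists_pos_forall_of_antitone
    (fun (pa : postCriticalSet f K × ι) (ε : ℝ) => (pa.1 : X) ∉ f pa.2 '' K →
      ∀ u ∈ f pa.2 '' K, ε ≤ dist u pa.1)
    (fun _ _ _ h hle he u hu => hle.trans (h he u hu))
    (fun pa => by
      by_cases he : (pa.1 : X) ∈ f pa.2 '' K
      · exact ⟨1, one_pos, fun h => absurd he h⟩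
      · obtain ⟨ε, hε, h⟩ := Metric.isOpen_iff.1 (hcomp pa.2).isClosed.isOpen_compl _ he
        refine ⟨ε, hε, fun _ u hu => ?_⟩
        by_contra! hlt
        exact h (mem_ball.2 hlt) hu)
  obtain ⟨c₀, hc₀, hang⟩ := hASC
  -- distance from a critical point to a cylinder that misses it but whose parent contains it
  have hcrit : ∀ (i j : ι) (I : List ι) (a : ι), i ≠ j → ∀ z ∈ wordMap f (i :: I) '' K,
      z ∈ f j '' K → z ∉ wordMap f (i :: I ++ [a]) '' K → ∀ u ∈ K,
      A ^ (i :: I).length * η ≤ dist (wordMap f (i :: I ++ [a]) u) z := by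
    rintro i j I a hij _ ⟨p, hp, rfl⟩ hzj hza u hu
    have hpP : p ∈ postCriticalSet f K := by
      refine ⟨hp, i :: I, List.cons_ne_nil _ _, ?_⟩
      simp only [criticalSet, mem_iUnion]
      exact ⟨i, j, hij, ⟨_, wordMap_mem hK.mapsTo I hp, rfl⟩, hzj⟩
    have hpa : p ∉ f a '' K := by
      rintro ⟨q, hq, rfl⟩
      exact hza ⟨q, hq, wordMap_append_singleton f (i :: I) a q⟩
    rw [wordMap_append_singleton]
    exact (mul_le_mul_of_nonneg_left (hpc (⟨p, hpP⟩, a) hpa _ ⟨u, hu, rfl⟩)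
      (pow_nonneg hA.le _)).trans (pow_length_mul_dist_le hA.le hf _ _ _)
  refine ⟨min δ (c₀ * η), lt_min hδ (mul_pos hc₀ hη), ?_⟩
  intro I
  induction I with
  | nil =>
    intro J a b hlen _ hd u hu v hv
    obtain rfl : J = [] := List.length_eq_zero_iff.1 hlen.symm
    rw [List.length_nil, pow_zero, mul_one]
    exact (min_le_left _ _).trans (hdisj (a, b) hd _ ⟨u, hu, rfl⟩ _ ⟨v, hv, rfl⟩)
  | cons i I ih =>
    intro J a b hlen hm hd u hu v hv
    obtain _ | ⟨j, J⟩ := J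
    · simp at hlen
    by_cases hij : i = j
    · subst hij
      have himg : ∀ L : List ι, wordMap f (i :: L) '' K = f i '' (wordMap f L '' K) :=
        fun L => image_comp _ _ _
      rw [List.cons_append, List.cons_append, himg, himg, ← image_inter (hinj i),
        image_eq_empty] at hd
      rw [himg, himg, ← image_inter (hinj i), image_nonempty] at hm
      have h1 := ih J a b (by simpa using hlen) hm hd u hu v hv
      calc min δ (c₀ * η) * A ^ (i :: I).length
          = A * (min δ (c₀ * η) * A ^ I.length) := by rw [List.length_cons]; ring
        _ ≤ A * _ := mul_le_mul_of_nonneg_left h1 hA.le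
        _ ≤ _ := hf i _ _
    · obtain ⟨z, hzI, hzJ⟩ := hm
      have hsub : ∀ (k : ι) (L : List ι), wordMap f (k :: L) '' K ⊆ f k '' K := by
        rintro k L _ ⟨p, hp, rfl⟩
        exact ⟨_, wordMap_mem hK.mapsTo L hp, rfl⟩
      have hzi := hsub i I hzI
      have hzj := hsub j J hzJ
      have hz : f i '' K ∩ f j '' K = {z} :=
        (hSIC i j hij).eq_singleton_of_mem ⟨hzi, hzj⟩
      have hASCuv := hang i j hij z hz _ (hsub i (I ++ [a]) ⟨u, hu, rfl⟩)
        _ (hsub j (J ++ [b]) ⟨v, hv, rfl⟩)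
      refine le_trans ?_ hASCuv
      have hmax : A ^ (i :: I).length * η ≤ max (dist (wordMap f (i :: I ++ [a]) u) z)
          (dist (wordMap f (j :: J ++ [b]) v) z) := by
        by_cases hza : z ∈ wordMap f (i :: I ++ [a]) '' K
        · have hzb : z ∉ wordMap f (j :: J ++ [b]) '' K := fun hzb =>
            (hd ▸ ⟨hza, hzb⟩ : z ∈ (∅ : Set X))
          rw [hlen]
          exact le_max_of_le_right (hcrit j i J b (Ne.symm hij) z hzJ hzi hzb v hv)
        · exact le_max_of_le_left (hcrit i j I a hij z hzI hzj hza u hu)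
      calc min δ (c₀ * η) * A ^ (i :: I).length ≤ c₀ * η * A ^ (i :: I).length :=
            mul_le_mul_of_nonneg_right (min_le_right _ _) (pow_nonneg hA.le _)
        _ = c₀ * (A ^ (i :: I).length * η) := by ring
        _ ≤ _ := mul_le_mul_of_nonneg_left hmax hc₀.le

end Attractor

/-- Passing from codings of `f` to codings of `g` is Hölder when the cylinders of `g` meet
whenever those of `f` do. -/
theorem exists_holder_bound_of_codings {X Y : Type*} [MetricSpace X] [MetricSpace Y]
    {ι : Type*} [Finite ι] {f : ι → X → X} {g : ι → Y → Y} {K : Set X} {K' : Set Y}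
    {πF : (ℕ → ι) → X} {πG : (ℕ → ι) → Y} (hK : IsAttractor f K) (hK' : IsAttractor g K')
    (hπF : IsCodingMap f K πF) (hπG : IsCodingMap g K' πG)
    (hpcf : (πF ⁻¹' postCriticalSet f K).Finite) (hSIC : SIC f K) (hASC : ASC f K)
    (hmeet : ∀ I J : List ι, I ≠ [] → I.length = J.length →
      (wordMap f I '' K ∩ wordMap f J '' K).Nonempty →
      (wordMap g I '' K' ∩ wordMap g J '' K').Nonempty)
    {A B s : ℝ} (hA : 0 < A) (hB : 0 ≤ B) (hB1 : B < 1) (hs : 0 ≤ s) (hABs : A ^ s = B)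
    (hfc : ∀ i, Continuous (f i)) (hf : ∀ i x y, A * dist x y ≤ dist (f i x) (f i y))
    (hg : ∀ i x y, dist (g i x) (g i y) ≤ B * dist x y) :
    ∃ C, 1 ≤ C ∧ ∀ x y, dist (πG x) (πG y) ≤ C * dist (πF x) (πF y) ^ s := by
  have hP : (postCriticalSet f K).Finite := by
    refine (hpcf.image πF).subset fun p hp => ?_
    obtain ⟨x, rfl⟩ := hπF.exists_code hK hp.1
    exact ⟨x, hp, rfl⟩
  obtain ⟨c, hc, hsep⟩ := exists_cylinder_separation hK hP hSIC hASC hA hfc hf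
  have hupper : ∀ x y n, (wordMap f (pre x n) '' K ∩ wordMap f (pre y n) '' K).Nonempty →
      dist (πG x) (πG y) ≤ 2 * diam K' * B ^ n := by
    intro x y n h
    refine hπG.dist_le_of_cylinders_meet hK' hB hg ?_
    cases n with
    | zero =>
      obtain ⟨p, hp⟩ := hK'.1
      exact ⟨p, ⟨p, hp, rfl⟩, ⟨p, hp, rfl⟩⟩
    | succ n =>
      refine hmeet _ _ ?_ (by simp only [length_pre]) h
      rw [pre_succ]
      simp
  refine ⟨max 1 (2 * diam K' / c ^ s), le_max_left _ _, fun x y => ?_⟩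
  by_cases hall : ∀ n, (wordMap f (pre x n) '' K ∩ wordMap f (pre y n) '' K).Nonempty
  · have hlim : Filter.Tendsto (fun n : ℕ => 2 * diam K' * B ^ n) Filter.atTop (nhds 0) := by
      simpa using (tendsto_pow_atTop_nhds_zero_of_lt_one hB hB1).const_mul (2 * diam K')
    refine (ge_of_tendsto' hlim fun n => hupper x y n (hall n)).trans ?_
    positivity
  · classical
    push Not at hall
    obtain ⟨m, hm⟩ : ∃ m, Nat.find hall = m + 1 := by
      refine Nat.exists_eq_succ_of_ne_zero fun h0 => ?_
      have h := Nat.find_spec hall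
      rw [h0] at h
      obtain ⟨p, hp⟩ := hK.1
      exact (h ▸ ⟨⟨p, hp, rfl⟩, ⟨p, hp, rfl⟩⟩ : p ∈ (∅ : Set X))
    have hdisj := Nat.find_spec hall
    rw [hm] at hdisj
    have hmm : (wordMap f (pre x m) '' K ∩ wordMap f (pre y m) '' K).Nonempty :=
      nonempty_iff_ne_empty.2 (Nat.find_min hall (m := m) (by omega))
    obtain ⟨u, hu, hux⟩ := hπF.mem_cylinder hK x (m + 1)
    obtain ⟨v, hv, hvy⟩ := hπF.mem_cylinder hK y (m + 1)
    rw [pre_succ] at hux hvy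
    rw [pre_succ, pre_succ] at hdisj
    have hlow := hsep (pre x m) (pre y m) (x m) (y m) (by simp only [length_pre]) hmm hdisj u hu
      v hv
    rw [hux, hvy, length_pre] at hlow
    have hcs : 0 < c ^ s := Real.rpow_pos_of_pos hc s
    have hpow : c ^ s * B ^ m ≤ dist (πF x) (πF y) ^ s := by
      have h := Real.rpow_le_rpow (by positivity) hlow hs
      rwa [Real.mul_rpow hc.le (by positivity), ← Real.rpow_pow_comm hA.le, hABs] at h
    calc dist (πG x) (πG y) ≤ 2 * diam K' * B ^ m := hupper x y m hmm
      _ = 2 * diam K' / c ^ s * (c ^ s * B ^ m) := by field_simp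
      _ ≤ 2 * diam K' / c ^ s * dist (πF x) (πF y) ^ s :=
        mul_le_mul_of_nonneg_left hpow (div_nonneg (by positivity) hcs.le)
      _ ≤ _ := mul_le_mul_of_nonneg_right (le_max_right _ _) (by positivity)

/-- A map between metric spaces satisfying a Hölder estimate is continuous. -/
theorem continuous_of_dist_le_rpow {X Y : Type*} [PseudoMetricSpace X] [PseudoMetricSpace Y]
    {h : X → Y} {C s : ℝ} (hs : 0 < s) (hh : ∀ x y, dist (h x) (h y) ≤ C * dist x y ^ s) :
    Continuous h := by
  refine continuous_iff_continuousAt.2 fun x => tendsto_iff_dist_tendsto_zero.2 ?_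
  refine squeeze_zero (fun _ => dist_nonneg) (fun y => hh y x) ?_
  have hcont : Continuous fun y => C * dist y x ^ s :=
    continuous_const.mul ((continuous_id.dist continuous_const).rpow_const fun _ => Or.inr hs.le)
  simpa [Real.zero_rpow hs.ne'] using hcont.tendsto x

/-- **Theorem (Hölder equivalence).**
If `F` and `G` are p.c.f. IFSs of bi-Lipschitz contractions on complete metric spaces,
both satisfying the SIC and the ASC, and `F`, `G` have the same topology automaton
(rendered combinatorially: corresponding cylinder sets are disjoint simultaneously), then
their attractors are Hölder equivalent. -/
theorem holder_equivalence_of_same_automaton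
    {X Y : Type*} [MetricSpace X] [MetricSpace Y] [CompleteSpace X] [CompleteSpace Y]
    {N : ℕ} (f : Fin N → X → X) (g : Fin N → Y → Y) (K : Set X) (K' : Set Y)
    (πF : (ℕ → Fin N) → X) (πG : (ℕ → Fin N) → Y)
    (hf : ∀ i, IsBiLipContraction (f i)) (hg : ∀ i, IsBiLipContraction (g i))
    (hK : IsAttractor f K) (hK' : IsAttractor g K')
    (hπF : IsCodingMap f K πF) (hπG : IsCodingMap g K' πG)
    (hpcfF : (πF ⁻¹' postCriticalSet f K).Finite)
    (hpcfG : (πG ⁻¹' postCriticalSet g K').Finite)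
    (hSICf : SIC f K) (hSICg : SIC g K')
    (hASCf : ASC f K) (hASCg : ASC g K')
    (hauto : ∀ I J : List (Fin N), I ≠ [] → I.length = J.length →
      ((wordMap f I '' K) ∩ (wordMap f J '' K) = ∅ ↔
        (wordMap g I '' K') ∩ (wordMap g J '' K') = ∅)) :
    ∃ (h : K ≃ₜ K') (C s : ℝ), 1 ≤ C ∧ 0 < s ∧ s ≤ 1 ∧
      ∀ x y : K, C⁻¹ * dist x y ^ (1 / s) ≤ dist (h x) (h y) ∧
        dist (h x) (h y) ≤ C * dist x y ^ s := by
  obtain ⟨ε₁, hε₁, hF⟩ := exists_uniform_biLipschitz hf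
  obtain ⟨ε₂, hε₂, hG⟩ := exists_uniform_biLipschitz hg
  obtain ⟨A, hA, hAh, hA₁, hA₂⟩ : ∃ A : ℝ, 0 < A ∧ A ≤ 1 / 2 ∧ A ≤ ε₁ ∧ A ≤ ε₂ :=
    ⟨min (1 / 2) (min ε₁ ε₂), by positivity, by simp, by simp, by simp⟩
  have hF := hF A hA₁
  have hG := hG A hA₂
  have hB : 0 < 1 - A := by linarith
  have hlogA : Real.log A < 0 := Real.log_neg hA (by linarith)
  have hlogB : Real.log (1 - A) < 0 := Real.log_neg hB (by linarith)
  obtain ⟨s, hs, hs1, hAs⟩ : ∃ s : ℝ, 0 < s ∧ s ≤ 1 ∧ A ^ s = 1 - A := by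
    refine ⟨Real.log (1 - A) / Real.log A, div_pos_of_neg_of_neg hlogB hlogA, ?_, ?_⟩
    · rw [div_le_one_of_neg hlogA]
      exact Real.log_le_log hA (by linarith)
    · rw [Real.rpow_def_of_pos hA, mul_div_cancel₀ _ hlogA.ne, Real.exp_log hB]
  obtain ⟨C₁, hC₁, hFG⟩ := exists_holder_bound_of_codings hK hK' hπF hπG hpcfF hSICf hASCf
    (fun I J hI hIJ => by
      simp only [nonempty_iff_ne_empty]
      exact mt (hauto I J hI hIJ).2)
    hA hB.le (by linarith) hs.le hAs
    (fun i => continuous_of_dist_le_rpow one_pos (C := 1 - A)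
      (by simpa using fun x y => (hF i x y).2))
    (fun i x y => (hF i x y).1) (fun i x y => (hG i x y).2)
  obtain ⟨C₂, hC₂, hGF⟩ := exists_holder_bound_of_codings hK' hK hπG hπF hpcfG hSICg hASCg
    (fun I J hI hIJ => by
      simp only [nonempty_iff_ne_empty]
      exact mt (hauto I J hI hIJ).1)
    hA hB.le (by linarith) hs.le hAs
    (fun i => continuous_of_dist_le_rpow one_pos (C := 1 - A)
      (by simpa using fun x y => (hG i x y).2))
    (fun i x y => (hG i x y).1) (fun i x y => (hF i x y).2)
  choose σ hσ using fun p : K => hπF.exists_code hK p.2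
  choose τ hτ using fun q : K' => hπG.exists_code hK' q.2
  have hFGeq : ∀ x y, πF x = πF y → πG x = πG y := fun x y h => by
    simpa [h, Real.zero_rpow hs.ne'] using hFG x y
  have hGFeq : ∀ x y, πG x = πG y → πF x = πF y := fun x y h => by
    simpa [h, Real.zero_rpow hs.ne'] using hGF x y
  let e : K ≃ K' :=
    { toFun := fun p => ⟨πG (σ p), hπG.mem hK' _⟩
      invFun := fun q => ⟨πF (τ q), hπF.mem hK _⟩
      left_inv := fun p => Subtype.ext ((hGFeq _ _ (hτ _)).trans (hσ p))
      right_inv := fun q => Subtype.ext ((hFGeq _ _ (hσ _)).trans (hτ q)) }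
  have he : ∀ x y, dist (e x) (e y) ≤ C₁ * dist x y ^ s := fun x y => by
    have h := hFG (σ x) (σ y)
    rwa [hσ, hσ] at h
  have hei : ∀ x y, dist (e.symm x) (e.symm y) ≤ C₂ * dist x y ^ s := fun x y => by
    have h := hGF (τ x) (τ y)
    rwa [hτ, hτ] at h
  have hC₂s : 1 ≤ C₂ ^ (1 / s) := Real.one_le_rpow hC₂ (by positivity)
  refine ⟨⟨e, continuous_of_dist_le_rpow hs he, continuous_of_dist_le_rpow hs hei⟩,
    max C₁ (C₂ ^ (1 / s)), s, le_max_of_le_left hC₁, hs, hs1, fun x y => ⟨?_, ?_⟩⟩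
  · have h := hei (e x) (e y)
    rw [e.symm_apply_apply, e.symm_apply_apply] at h
    have h' := Real.rpow_le_rpow dist_nonneg h (one_div_pos.2 hs).le
    rw [Real.mul_rpow (by linarith) (by positivity), ← Real.rpow_mul dist_nonneg,
      mul_one_div_cancel hs.ne', Real.rpow_one] at h'
    rw [inv_mul_le_iff₀ (by positivity)]
    exact h'.trans (mul_le_mul_of_nonneg_right (le_max_right _ _) dist_nonneg)
  · exact (he x y).trans (mul_le_mul_of_nonneg_right (le_max_left _ _) (by positivity))
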